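/- Let X₁ be a J × N real matrix, Y a J × M real matrix, B an N × R real matrix and C an M × R real matrix, and define f(U) = ‖X₁ − U Bᵀ‖² + ‖Y − U Cᵀ‖² for J × R real matrices U (squared Frobenius norms). Fix U with all entries nonnegative, indices j, r, set g = (U BᵀB − X₁ B + U CᵀC − Y C)_{j r} and h = (BᵀB)_{r r} + (CᵀC)_{r r} with h > 0, and let U' be U with its (j,r) entry replaced by max(0, U_{j r} − g/h). Then f(U') ≤ f(U) and all entries of U' are nonnegative. -/

import Mathlib

open scoped BigOperators
open Matrix

/-- Squared Frobenius norm: sum of squares of the entries. -/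
def frobSq {m n : Type*} [Fintype m] [Fintype n] (A : Matrix m n ℝ) : ℝ :=
  ∑ i, ∑ j, A i j ^ 2

/-- Replace the (j,r) entry of U by v. -/
def updEntry {J R : ℕ} (U : Matrix (Fin J) (Fin R) ℝ) (j : Fin J) (r : Fin R) (v : ℝ) :
    Matrix (Fin J) (Fin R) ℝ :=
  Matrix.of fun a b => if a = j ∧ b = r then v else U a b

theorem updEntry_mul_apply {J K R : ℕ} (U : Matrix (Fin J) (Fin R) ℝ) (D : Matrix (Fin R) (Fin K) ℝ)
    (j : Fin J) (r : Fin R) (v : ℝ) (i : Fin J) (k : Fin K) :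
    (updEntry U j r v * D) i k = (U * D) i k + if i = j then (v - U j r) * D r k else 0 := by
  have hentry : ∀ b, updEntry U j r v i b * D b k =
      U i b * D b k + if b = r then (if i = j then (v - U j r) * D r k else 0) else 0 := by
    intro b
    by_cases hi : i = j <;> by_cases hb : b = r
    · subst hi hb
      simp only [updEntry, Matrix.of_apply, and_self, if_true]
      ring
    all_goals simp [updEntry, hi, hb]
  simp only [Matrix.mul_apply, hentry, Finset.sum_add_distrib, Finset.sum_ite_eq',
    Finset.mem_univ, if_true]

/-- The least-squares objective is quadratic in each entry of the factor matrix. -/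
theorem frobSq_sub_updEntry_mul_transpose {J K R : ℕ} (X : Matrix (Fin J) (Fin K) ℝ)
    (B : Matrix (Fin K) (Fin R) ℝ) (U : Matrix (Fin J) (Fin R) ℝ) (j : Fin J) (r : Fin R) (v : ℝ) :
    frobSq (X - updEntry U j r v * Bᵀ) = frobSq (X - U * Bᵀ) +
      2 * (v - U j r) * (U * Bᵀ * B - X * B) j r + (v - U j r) ^ 2 * (Bᵀ * B) r r := by
  have hrow : ∀ i, ∑ k, (X - updEntry U j r v * Bᵀ) i k ^ 2 =
      ∑ k, (X - U * Bᵀ) i k ^ 2 + if i = j then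
        2 * (v - U j r) * (U * Bᵀ * B - X * B) j r + (v - U j r) ^ 2 * (Bᵀ * B) r r else 0 := by
    intro i
    by_cases hi : i = j
    · subst hi
      rw [← Matrix.sub_mul, Matrix.mul_apply (M := U * Bᵀ - X), Matrix.mul_apply (M := Bᵀ)]
      simp only [if_true, Finset.mul_sum, ← Finset.sum_add_distrib]
      refine Finset.sum_congr rfl fun k _ => ?_
      simp only [Matrix.sub_apply, updEntry_mul_apply, Matrix.transpose_apply, if_true]
      ring
    · simp [updEntry_mul_apply, hi]
  simp only [frobSq, hrow, Finset.sum_add_distrib, Finset.sum_ite_eq', Finset.mem_univ, if_true]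
  ring

/-- The projected Newton step does not increase a convex quadratic. -/
theorem quadratic_projected_step_nonpos {u g h : ℝ} (hu : 0 ≤ u) (hh : 0 < h) :
    2 * (max 0 (u - g / h) - u) * g + (max 0 (u - g / h) - u) ^ 2 * h ≤ 0 := by
  obtain ⟨q, rfl⟩ : ∃ q, g = q * h := ⟨g / h, by field_simp⟩
  rw [mul_div_cancel_right₀ q hh.ne']
  rcases le_total 0 (u - q) with hq | hq
  · rw [max_eq_right hq]
    nlinarith [mul_nonneg (sq_nonneg q) hh.le]
  · rw [max_eq_left hq]
    have hprod : 0 ≤ u * (2 * q - u) * h := by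
      refine mul_nonneg (mul_nonneg hu ?_) hh.le
      linarith
    linarith

/-- Monotone decrease of a single Cut-CD coordinate update: it never increases the N-CMTF
objective and preserves nonnegativity of the factor matrix. -/
theorem coordinate_update_decreases {J N M R : ℕ}
    (X₁ : Matrix (Fin J) (Fin N) ℝ) (Y : Matrix (Fin J) (Fin M) ℝ)
    (B : Matrix (Fin N) (Fin R) ℝ) (C : Matrix (Fin M) (Fin R) ℝ)
    (U : Matrix (Fin J) (Fin R) ℝ) (hU : ∀ a b, 0 ≤ U a b) (j : Fin J) (r : Fin R) :
    let f : Matrix (Fin J) (Fin R) ℝ → ℝ :=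
      fun A => frobSq (X₁ - A * Bᵀ) + frobSq (Y - A * Cᵀ)
    let g : ℝ := (U * Bᵀ * B - X₁ * B + U * Cᵀ * C - Y * C) j r
    let h : ℝ := (Bᵀ * B) r r + (Cᵀ * C) r r
    0 < h →
    (f (updEntry U j r (max 0 (U j r - g / h))) ≤ f U ∧
      ∀ a b, 0 ≤ updEntry U j r (max 0 (U j r - g / h)) a b) := by
  intro f g h hh
  constructor
  · have hg : g = (U * Bᵀ * B - X₁ * B) j r + (U * Cᵀ * C - Y * C) j r := by
      simp only [g, Matrix.sub_apply, Matrix.add_apply]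
      ring
    have hstep := quadratic_projected_step_nonpos (g := g) (hU j r) hh
    generalize max 0 (U j r - g / h) = v at hstep ⊢
    simp only [f, frobSq_sub_updEntry_mul_transpose]
    rw [hg] at hstep
    simp only [h] at hstep
    linarith
  · intro a b
    simp only [updEntry, Matrix.of_apply]
    split_ifs
    · exact le_max_left _ _
    · exact hU a b
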